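/- In any normal and neutral deduction of Γ ⊢ C in the natural deduction system IEL⁻, the set of open hypotheses Γ is nonempty; equivalently, no closed normal deduction is neutral. -/

import Mathlib

/-- Types of the modal λ-calculus. -/
inductive Ty : Type
  | unit : Ty
  | empty : Ty
  | atom : ℕ → Ty
  | arrow : Ty → Ty → Ty
  | prod : Ty → Ty → Ty
  | sum : Ty → Ty → Ty
  | box : Ty → Ty
  deriving DecidableEq

/-- Terms of the modal λ-calculus (named variables). -/
inductive Tm : Type
  | var : ℕ → Tm
  | lam : ℕ → Tm → Tm
  | app : Tm → Tm → Tm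
  | pair : Tm → Tm → Tm
  | fst : Tm → Tm
  | snd : Tm → Tm
  | inl : Tm → Tm
  | inr : Tm → Tm
  | case : Tm → ℕ → Tm → ℕ → Tm → Tm
  | abort : Tm → Tm
  | unit : Tm
  | box : List (ℕ × Tm) → Tm → Tm

namespace Tm

/-- Substitution `t[u/x]` (naive, variable-name based). -/
def subst (x : ℕ) (u : Tm) : Tm → Tm
  | .var y => if y = x then u else .var y
  | .lam y t => if y = x then .lam y t else .lam y (subst x u t)
  | .app t s => .app (subst x u t) (subst x u s)
  | .pair t s => .pair (subst x u t) (subst x u s)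
  | .fst t => .fst (subst x u t)
  | .snd t => .snd (subst x u t)
  | .inl t => .inl (subst x u t)
  | .inr t => .inr (subst x u t)
  | .case t y u₁ z u₂ =>
      .case (subst x u t) y (if y = x then u₁ else subst x u u₁)
        z (if z = x then u₂ else subst x u u₂)
  | .abort t => .abort (subst x u t)
  | .unit => .unit
  | .box ps s =>
      .box (ps.attach.map (fun p => (p.1.1, subst x u p.1.2)))
        (if x ∈ ps.map Prod.fst then s else subst x u s)
decreasing_by
  all_goals simp_wf
  all_goals try omega
  · obtain ⟨⟨a, b⟩, hp⟩ := p
    have h1 := List.sizeOf_lt_of_mem hp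
    simp at h1 ⊢
    omega

/-- `freeIn x t` : the variable `x` occurs free in `t`. -/
def freeIn (x : ℕ) : Tm → Prop
  | .var y => y = x
  | .lam y t => y ≠ x ∧ freeIn x t
  | .app t s => freeIn x t ∨ freeIn x s
  | .pair t s => freeIn x t ∨ freeIn x s
  | .fst t => freeIn x t
  | .snd t => freeIn x t
  | .inl t => freeIn x t
  | .inr t => freeIn x t
  | .case t y u z v => freeIn x t ∨ (y ≠ x ∧ freeIn x u) ∨ (z ≠ x ∧ freeIn x v)
  | .abort t => freeIn x t
  | .unit => False
  | .box ps s =>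
      (∃ p : {a // a ∈ ps}, freeIn x p.1.2) ∨ (x ∉ ps.map Prod.fst ∧ freeIn x s)
decreasing_by
  all_goals simp_wf
  all_goals try omega
  · obtain ⟨⟨a, b⟩, hp⟩ := p
    have h1 := List.sizeOf_lt_of_mem hp
    simp at h1 ⊢
    omega

end Tm

/-- One-step reduction `t ▷ t'`: βη-reductions, permutative (commuting)
conversions, the modal reductions (ι) and (δ), and compatible (congruence) closure. -/
inductive Step : Tm → Tm → Prop
  -- β-reductions
  | beta_arrow {x t u} : Step (.app (.lam x t) u) (t.subst x u)
  | beta_fst {t s} : Step (.fst (.pair t s)) t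
  | beta_snd {t s} : Step (.snd (.pair t s)) s
  | beta_inl {t x u y v} : Step (.case (.inl t) x u y v) (u.subst x t)
  | beta_inr {t x u y v} : Step (.case (.inr t) x u y v) (v.subst y t)
  -- η-reductions
  | eta_arrow {x t} : ¬ t.freeIn x → Step (.lam x (.app t (.var x))) t
  | eta_prod {t} : Step (.pair (.fst t) (.snd t)) t
  | eta_sum {t x y} : Step (.case t x (.inl (.var x)) y (.inr (.var y))) t
  -- permutative conversions for ∨-elimination
  | perm_app_case {t x u y v w} :
      Step (.app (.case t x u y v) w) (.case t x (.app u w) y (.app v w))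
  | perm_fst_case {t x u y v} :
      Step (.fst (.case t x u y v)) (.case t x (.fst u) y (.fst v))
  | perm_snd_case {t x u y v} :
      Step (.snd (.case t x u y v)) (.case t x (.snd u) y (.snd v))
  | perm_case_case {t x u y v z w₁ z' w₂} :
      Step (.case (.case t x u y v) z w₁ z' w₂)
        (.case t x (.case u z w₁ z' w₂) y (.case v z w₁ z' w₂))
  | perm_abort_case {t x u y v} :
      Step (.abort (.case t x u y v)) (.case t x (.abort u) y (.abort v))
  -- permutative conversions for ⊥-elimination
  | perm_app_abort {t w} : Step (.app (.abort t) w) (.abort t)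
  | perm_fst_abort {t} : Step (.fst (.abort t)) (.abort t)
  | perm_snd_abort {t} : Step (.snd (.abort t)) (.abort t)
  | perm_case_abort {t x u y v} : Step (.case (.abort t) x u y v) (.abort t)
  | perm_abort_abort {t} : Step (.abort (.abort t)) (.abort t)
  -- modal reductions
  | iota {x t} : Step (.box [(x, t)] (.var x)) t
  | delta {ps₁ ps₂ : List (ℕ × Tm)} {x qs u r} :
      Step (.box (ps₁ ++ (x, .box qs u) :: ps₂) r)
        (.box (ps₁ ++ qs ++ ps₂) (r.subst x u))
  -- compatible (congruence) closure
  | congr_lam {x t t'} : Step t t' → Step (.lam x t) (.lam x t')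
  | congr_app_left {t t' s} : Step t t' → Step (.app t s) (.app t' s)
  | congr_app_right {t s s'} : Step s s' → Step (.app t s) (.app t s')
  | congr_pair_left {t t' s} : Step t t' → Step (.pair t s) (.pair t' s)
  | congr_pair_right {t s s'} : Step s s' → Step (.pair t s) (.pair t s')
  | congr_fst {t t'} : Step t t' → Step (.fst t) (.fst t')
  | congr_snd {t t'} : Step t t' → Step (.snd t) (.snd t')
  | congr_inl {t t'} : Step t t' → Step (.inl t) (.inl t')
  | congr_inr {t t'} : Step t t' → Step (.inr t) (.inr t')
  | congr_case_scrut {t t' x u y v} :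
      Step t t' → Step (.case t x u y v) (.case t' x u y v)
  | congr_case_left {t x u u' y v} :
      Step u u' → Step (.case t x u y v) (.case t x u' y v)
  | congr_case_right {t x u y v v'} :
      Step v v' → Step (.case t x u y v) (.case t x u y v')
  | congr_abort {t t'} : Step t t' → Step (.abort t) (.abort t')
  | congr_box_body {ps s s'} : Step s s' → Step (.box ps s) (.box ps s')
  | congr_box_arg {ps₁ ps₂ : List (ℕ × Tm)} {x t t' s} :
      Step t t' → Step (.box (ps₁ ++ (x, t) :: ps₂) s) (.box (ps₁ ++ (x, t') :: ps₂) s)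

/-- Typing contexts: association lists of (variable, type). -/
abbrev Ctx : Type := List (ℕ × Ty)

/-- Typing judgement for the modal λ-calculus of IEL⁻-deductions. -/
inductive Typed : Ctx → Tm → Ty → Prop
  | var {Γ x A} : List.lookup x Γ = some A → Typed Γ (.var x) A
  | lam {Γ x A t B} : Typed ((x, A) :: Γ) t B → Typed Γ (.lam x t) (.arrow A B)
  | app {Γ t s A B} : Typed Γ t (.arrow A B) → Typed Γ s A → Typed Γ (.app t s) B
  | pair {Γ t s A B} : Typed Γ t A → Typed Γ s B → Typed Γ (.pair t s) (.prod A B)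
  | fst {Γ t A B} : Typed Γ t (.prod A B) → Typed Γ (.fst t) A
  | snd {Γ t A B} : Typed Γ t (.prod A B) → Typed Γ (.snd t) B
  | inl {Γ t A B} : Typed Γ t A → Typed Γ (.inl t) (.sum A B)
  | inr {Γ t A B} : Typed Γ t B → Typed Γ (.inr t) (.sum A B)
  | case {Γ t x u y v A B D} :
      Typed Γ t (.sum A B) → Typed ((x, A) :: Γ) u D → Typed ((y, B) :: Γ) v D →
      Typed Γ (.case t x u y v) D
  | abort {Γ t A} : Typed Γ t .empty → Typed Γ (.abort t) A
  | unit {Γ} : Typed Γ .unit .unit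
  | box {Γ : Ctx} {ps : List (ℕ × Tm)} {As : List Ty} {s B} :
      ps.length = As.length →
      (∀ pA ∈ ps.zip As, Typed Γ pA.1.2 (Ty.box pA.2)) →
      Typed (((ps.map Prod.fst).zip As) ++ Γ) s B →
      Typed Γ (.box ps s) (Ty.box B)

/-- A deduction (term) is neutral iff it is a hypothesis (variable) or its
last rule is an elimination rule. -/
def Neutral : Tm → Prop
  | .var _ => True
  | .app _ _ => True
  | .fst _ => True
  | .snd _ => True
  | .case _ _ _ _ _ => True
  | .abort _ => True
  | _ => False

/-- in any normal and neutral deduction of Γ ⊢ C the set of open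
hypotheses Γ is nonempty; equivalently, no closed normal deduction is neutral. -/
theorem neutral_normal_has_hypotheses {Γ : Ctx} {t : Tm} {C : Ty}
    (ht : Typed Γ t C) (hnorm : ∀ u : Tm, ¬ Step t u) (hneut : Neutral t) :
    Γ ≠ [] := by
  induction ht with
  | var h =>
    rintro rfl
    simp at h
  | app h _ ih _ =>
    have ih := ih fun u hu => hnorm _ (.congr_app_left hu)
    cases h with
    | lam _ => exact absurd .beta_arrow (hnorm _)
    | _ => exact ih trivial
  | fst h ih =>
    have ih := ih fun u hu => hnorm _ (.congr_fst hu)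
    cases h with
    | pair _ _ => exact absurd .beta_fst (hnorm _)
    | _ => exact ih trivial
  | snd h ih =>
    have ih := ih fun u hu => hnorm _ (.congr_snd hu)
    cases h with
    | pair _ _ => exact absurd .beta_snd (hnorm _)
    | _ => exact ih trivial
  | case h _ _ ih _ _ =>
    have ih := ih fun u hu => hnorm _ (.congr_case_scrut hu)
    cases h with
    | inl _ => exact absurd .beta_inl (hnorm _)
    | inr _ => exact absurd .beta_inr (hnorm _)
    | _ => exact ih trivial
  | abort h ih =>
    have ih := ih fun u hu => hnorm _ (.congr_abort hu)
    cases h <;> exact ih trivial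
  | _ => exact hneut.elim
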